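/- arXiv:2003.01232 — 2 statements merged into one kernel-verified Lean document; each statement's English description precedes it below -/
import Mathlib

section
/- If Ω is a nonempty, bounded, connected, open subset of ℂ, then Ω + Ω ⊆ ∂Ω + ∂Ω, i.e., for any z₁, z₂ ∈ Ω there exist z₃, z₄ ∈ ∂Ω (the topological frontier of Ω) with z₁ + z₂ = z₃ + z₄. -/
open Set Metric

lemma IsPreconnected.mul_pos_of_continuousOn_of_ne_zero {X : Type*} [TopologicalSpace X]
    {S : Set X} (hS : IsPreconnected S) {φ : X → ℝ} (hφ : ContinuousOn φ S)
    (h₀ : ∀ x ∈ S, φ x ≠ 0) {x y : X} (hx : x ∈ S) (hy : y ∈ S) : 0 < φ x * φ y := by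
  by_contra! hle
  suffices (0 : ℝ) ∈ φ '' S by
    obtain ⟨z, hz, hz₀⟩ := this
    exact h₀ z hz hz₀
  rcases mul_nonpos_iff.mp hle with h | h
  · exact hS.intermediate_value hy hx hφ ⟨h.2, h.1⟩
  · exact hS.intermediate_value hx hy hφ h

/-- If a continuous function on the plane is positive on a connected set containing a pair of points
symmetric about `c / 2` and negative on another such set, then it vanishes at both points of some
pair symmetric about `c / 2`. -/
lemma exists_eq_zero_and_sub_eq_zero {g : ℂ → ℝ} (hg : Continuous g) (c : ℂ) {S T : Set ℂ}
    (hS : IsPreconnected S) (hT : IsPreconnected T) (hgS : ∀ z ∈ S, 0 < g z)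
    (hgT : ∀ z ∈ T, g z < 0) {x y : ℂ} (hx : x ∈ S) (hx' : c - x ∈ S) (hy : y ∈ T)
    (hy' : c - y ∈ T) : ∃ z, g z = 0 ∧ g (c - z) = 0 := by
  by_contra! hne
  let f : ℂ → ℂ := fun z ↦ ⟨g z, g (c - z)⟩
  have hf : Continuous f := by
    have : f = fun z ↦ (g z : ℂ) + g (c - z) * Complex.I := by
      funext z
      exact Complex.mk_eq_add_mul_I _ _
    rw [this]
    fun_prop
  have hf₀ : (0 : ℂ) ∉ f '' univ := by
    rintro ⟨z, -, hz⟩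
    exact hne z (congrArg Complex.re hz) (congrArg Complex.im hz)
  -- a continuous square root of `f`
  have hsc : IsSimplyConnected (univ : Set ℂ) := by
    have := (convex_univ (𝕜 := ℝ) (E := ℂ)).contractibleSpace univ_nonempty
    exact SimplyConnectedSpace.ofContractible _
  obtain ⟨s, hs, hsf⟩ := Complex.exists_continuousOn_pow_eq hsc
    isOpen_univ hf.continuousOn hf₀ two_ne_zero
  replace hs : Continuous s := continuousOn_univ.mp hs
  have hre (z : ℂ) : (s z).re ^ 2 - (s z).im ^ 2 = g z := by
    have := congrArg Complex.re (hsf z)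
    simp only [sq, Complex.mul_re, f] at this ⊢
    exact this
  have him (z : ℂ) : 2 * ((s z).re * (s z).im) = g (c - z) := by
    have := congrArg Complex.im (hsf z)
    simp only [sq, Complex.mul_im, f] at this
    linarith
  let P : ℂ → ℝ := fun z ↦ (s z).re * (s (c - z)).im + (s z).im * (s (c - z)).re
  have hP : Continuous P := by fun_prop
  have hP₀ (z : ℂ) : P z ≠ 0 := by
    intro h
    have h₁ := hre z
    have h₂ := him z
    have h₃ := hre (c - z)
    have h₄ := him (c - z)
    rw [sub_sub_cancel] at h₄
    have hsum : g z ^ 2 + g (c - z) ^ 2 = 0 := by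
      calc g z ^ 2 + g (c - z) ^ 2
          = ((s z).re ^ 2 - (s z).im ^ 2) * (2 * ((s (c - z)).re * (s (c - z)).im))
            + (2 * ((s z).re * (s z).im)) * ((s (c - z)).re ^ 2 - (s (c - z)).im ^ 2) := by
            rw [h₁, h₂, h₃, h₄]; ring
        _ = 2 * P z * ((s z).re * (s (c - z)).re - (s z).im * (s (c - z)).im) := by
            simp only [P]; ring
        _ = 0 := by rw [h]; ring
    exact hne z (by nlinarith [sq_nonneg (g z), sq_nonneg (g (c - z))])
      (by nlinarith [sq_nonneg (g z), sq_nonneg (g (c - z))])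
  have hPx : 0 < P x := by
    have hpos : 0 < (s x).re * (s (c - x)).re :=
      hS.mul_pos_of_continuousOn_of_ne_zero (φ := fun z ↦ (s z).re) (by fun_prop)
        (fun z hz h ↦ by
          have := hre z
          rw [h] at this
          nlinarith [hgS z hz, sq_nonneg (s z).im]) hx hx'
    have h₁ : 0 < (s x).re * (s x).im := by linarith [him x, hgS _ hx']
    have h₂ : 0 < (s (c - x)).re * (s (c - x)).im := by
      have := him (c - x)
      rw [sub_sub_cancel] at this
      linarith [hgS _ hx]
    have hr : (s x).re ≠ 0 := left_ne_zero_of_mul hpos.ne'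
    have hmul : 0 < (s x).re * (s (c - x)).re * P x := by
      have : (s x).re * (s (c - x)).re * P x = (s x).re ^ 2 * ((s (c - x)).re * (s (c - x)).im)
          + (s (c - x)).re ^ 2 * ((s x).re * (s x).im) := by simp only [P]; ring
      rw [this]
      positivity
    exact pos_of_mul_pos_right hmul hpos.le
  have hPy : P y < 0 := by
    have hpos : 0 < (s y).im * (s (c - y)).im :=
      hT.mul_pos_of_continuousOn_of_ne_zero (φ := fun z ↦ (s z).im) (by fun_prop)
        (fun z hz h ↦ by
          have := hre z
          rw [h] at this
          nlinarith [hgT z hz, sq_nonneg (s z).re]) hy hy'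
    have h₁ : 0 < -((s y).re * (s y).im) := by linarith [him y, hgT _ hy']
    have h₂ : 0 < -((s (c - y)).re * (s (c - y)).im) := by
      have := him (c - y)
      rw [sub_sub_cancel] at this
      linarith [hgT _ hy]
    have hi : (s y).im ≠ 0 := left_ne_zero_of_mul hpos.ne'
    have hmul : 0 < (s y).im * (s (c - y)).im * -P y := by
      have : (s y).im * (s (c - y)).im * -P y
          = (s y).im ^ 2 * -((s (c - y)).re * (s (c - y)).im)
            + (s (c - y)).im ^ 2 * -((s y).re * (s y).im) := by simp only [P]; ring
      rw [this]
      positivity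
    exact neg_pos.mp (pos_of_mul_pos_right hmul hpos.le)
  have := isPreconnected_univ.mul_pos_of_continuousOn_of_ne_zero hP.continuousOn
    (fun z _ ↦ hP₀ z) (mem_univ x) (mem_univ y)
  nlinarith

theorem add_self_subset_frontier_add_frontier_of_isOpen
    (Ω : Set ℂ) (hne : Ω.Nonempty) (hbdd : Bornology.IsBounded Ω)
    (hconn : IsConnected Ω) (hopen : IsOpen Ω) :
    ∀ z₁ ∈ Ω, ∀ z₂ ∈ Ω, ∃ z₃ ∈ frontier Ω, ∃ z₄ ∈ frontier Ω,
      z₁ + z₂ = z₃ + z₄ := by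
  intro z₁ hz₁ z₂ hz₂
  obtain ⟨R, hR, hsub⟩ := hbdd.closure.subset_ball_lt 0 ((z₁ + z₂) / 2)
  have hsphere : ∀ z ∈ sphere ((z₁ + z₂) / 2) R, z ∉ closure Ω := fun z hz h ↦
    (mem_ball.mp (hsub h)).ne (mem_sphere.mp hz)
  obtain ⟨y, hy⟩ : (sphere ((z₁ + z₂) / 2) R).Nonempty := NormedSpace.sphere_nonempty.mpr hR.le
  have hy' : z₁ + z₂ - y ∈ sphere ((z₁ + z₂) / 2) R := by
    rw [mem_sphere_iff_norm] at hy ⊢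
    rw [← hy, ← norm_neg]
    congr 1
    ring
  have hcne : Ωᶜ.Nonempty := ⟨y, fun h ↦ hsphere y hy (subset_closure h)⟩
  let g : ℂ → ℝ := fun z ↦ infDist z Ωᶜ - infDist z Ω
  have hg : Continuous g := (continuous_infDist_pt _).sub (continuous_infDist_pt _)
  have hgΩ : ∀ z ∈ Ω, 0 < g z := fun z hz ↦ by
    have := (hopen.isClosed_compl.notMem_iff_infDist_pos hcne).mp (not_not_intro hz)
    simpa [g, infDist_zero_of_mem hz] using this
  have hgext : ∀ z ∉ closure Ω, g z < 0 := fun z hz ↦ by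
    have := (infDist_pos_iff_notMem_closure hne).mp hz
    have hzc : z ∈ Ωᶜ := fun h ↦ hz (subset_closure h)
    simpa [g, infDist_zero_of_mem hzc] using this
  have hfront (z : ℂ) (hz : g z = 0) : z ∈ frontier Ω := by
    rw [hopen.frontier_eq]
    exact ⟨by_contra fun h ↦ (hgext z h).ne hz, fun h ↦ (hgΩ z h).ne' hz⟩
  obtain ⟨z, hz, hz'⟩ := exists_eq_zero_and_sub_eq_zero hg (z₁ + z₂) hconn.isPreconnected
    (isPreconnected_sphere (Complex.rank_real_complex ▸ Nat.one_lt_ofNat) _ R) hgΩ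
    (fun z hz ↦ hgext z (hsphere z hz)) hz₁ (by simpa using hz₂) hy hy'
  exact ⟨z, hfront z hz, _, hfront _ hz', by ring⟩
end

section
/- Let C be a conjugation on a complex Hilbert space H, A a trace-class operator with C A C = A*, and B ∈ B(H) with C B C = −B*. Then tr(AB) = 0. -/
open scoped InnerProductSpace
open ContinuousLinearMap (adjoint adjoint_inner_left adjoint_inner_right)

section HilbertSchmidt

variable {H : Type*} [NormedAddCommGroup H] [InnerProductSpace ℂ H]

/-- Parseval's identity. -/
theorem HilbertBasis.hasSum_norm_inner_sq {ι : Type*} (b : HilbertBasis ι ℂ H) (x : H) :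
    HasSum (fun i => ‖⟪b i, x⟫_ℂ‖ ^ 2) (‖x‖ ^ 2) := by
  have h := Complex.hasSum_re (b.hasSum_inner_mul_inner x x)
  convert h using 1
  · ext i
    have := inner_mul_symm_re_eq_norm (𝕜 := ℂ) x (b i)
    rw [norm_mul, norm_inner_symm x, ← sq] at this
    exact this.symm
  · exact (inner_self_eq_norm_sq (𝕜 := ℂ) x).symm

/-- The matrix of a Hilbert–Schmidt operator is square summable. -/
theorem summable_norm_matrix_sq {ι κ : Type*} (b : HilbertBasis ι ℂ H)
    (c : HilbertBasis κ ℂ H) {T : H →L[ℂ] H} (hT : Summable fun i => ‖T (b i)‖ ^ 2) :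
    Summable fun p : ι × κ => ‖⟪c p.2, T (b p.1)⟫_ℂ‖ ^ 2 := by
  rw [summable_prod_of_nonneg fun p => sq_nonneg _]
  refine ⟨fun i => (c.hasSum_norm_inner_sq (T (b i))).summable, hT.congr fun i => ?_⟩
  exact (c.hasSum_norm_inner_sq (T (b i))).tsum_eq.symm

variable [CompleteSpace H]

/-- The adjoint of a Hilbert–Schmidt operator is Hilbert–Schmidt, in any Hilbert basis. -/
theorem summable_norm_adjoint_sq {ι κ : Type*} (b : HilbertBasis ι ℂ H)
    (c : HilbertBasis κ ℂ H) {T : H →L[ℂ] H} (hT : Summable fun i => ‖T (b i)‖ ^ 2) :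
    Summable fun j => ‖adjoint T (c j)‖ ^ 2 := by
  refine (summable_norm_matrix_sq b c hT).prod_symm.prod.congr fun j => ?_
  rw [← (b.hasSum_norm_inner_sq _).tsum_eq]
  refine tsum_congr fun i => ?_
  rw [adjoint_inner_right, norm_inner_symm]
  rfl

/-- The trace of a product of two Hilbert–Schmidt operators is cyclic and independent of the
Hilbert basis. -/
theorem hasSum_trace_mul_comm {ι κ : Type*} (b : HilbertBasis ι ℂ H)
    (c : HilbertBasis κ ℂ H) {X Y : H →L[ℂ] H}
    (hX : Summable fun i => ‖adjoint X (b i)‖ ^ 2) (hY : Summable fun i => ‖Y (b i)‖ ^ 2) :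
    HasSum (fun j => ⟪c j, (Y * X) (c j)⟫_ℂ) (∑' i, ⟪b i, (X * Y) (b i)⟫_ℂ) := by
  let F : ι × κ → ℂ := fun p => ⟪adjoint X (b p.1), c p.2⟫_ℂ * ⟪c p.2, Y (b p.1)⟫_ℂ
  have hF : Summable F := by
    refine Summable.of_norm_bounded
      ((summable_norm_matrix_sq b c hX).add (summable_norm_matrix_sq b c hY)) fun p => ?_
    rw [norm_mul, norm_inner_symm]
    nlinarith [sq_nonneg (‖⟪c p.2, adjoint X (b p.1)⟫_ℂ‖ - ‖⟪c p.2, Y (b p.1)⟫_ℂ‖),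
      sq_nonneg ‖⟪c p.2, adjoint X (b p.1)⟫_ℂ‖, sq_nonneg ‖⟪c p.2, Y (b p.1)⟫_ℂ‖]
  have hrow : ∀ i, HasSum (fun j => F (i, j)) ⟪b i, (X * Y) (b i)⟫_ℂ := fun i => by
    simpa [F, adjoint_inner_left] using c.hasSum_inner_mul_inner (adjoint X (b i)) (Y (b i))
  have hcol : ∀ j, HasSum (fun i => F (i, j)) ⟪c j, (Y * X) (c j)⟫_ℂ := fun j => by
    have h := b.hasSum_inner_mul_inner (adjoint Y (c j)) (X (c j))
    simp only [adjoint_inner_left] at h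
    simpa only [F, adjoint_inner_left, mul_comm, mul_apply_eq_comp,
      ContinuousLinearMap.comp_apply] using h
  have hsum := (hF.hasSum.prod_fiberwise hrow).tsum_eq
  rw [hsum]
  have hswap : HasSum (F ∘ Prod.swap) (∑' p, F p) :=
    (Equiv.prodComm κ ι).hasSum_iff.2 hF.hasSum
  exact hswap.prod_fiberwise hcol

end HilbertSchmidt

section Polar

variable {H : Type*} [NormedAddCommGroup H] [InnerProductSpace ℂ H] [CompleteSpace H]

/-- Operators with the same pointwise norms differ by a bounded left factor. -/
theorem exists_mul_eq_of_norm_eq {S T : H →L[ℂ] H} (h : ∀ x, ‖T x‖ = ‖S x‖) :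
    ∃ V : H →L[ℂ] H, V * S = T := by
  let K := S.range.topologicalClosure
  have hmem : ∀ x, S x ∈ K := fun x => S.range.le_topologicalClosure ⟨x, rfl⟩
  let e : H →ₗ[ℂ] K := S.toLinearMap.codRestrict K hmem
  have he : DenseRange e := by
    intro y
    rw [closure_subtype]
    refine closure_mono ?_ y.2
    rintro _ ⟨x, rfl⟩
    exact ⟨e x, ⟨x, rfl⟩, rfl⟩
  refine ⟨(T.toLinearMap.extendOfNorm e).comp K.orthogonalProjectionOnto, ?_⟩
  ext x
  have hx : K.orthogonalProjectionOnto (S x) = e x :=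
    K.orthogonalProjectionOnto_mem_subspace_eq_self (e x)
  simp only [mul_apply_eq_comp, ContinuousLinearMap.comp_apply, hx]
  exact LinearMap.extendOfNorm_eq he ⟨1, fun x => by simpa [e] using (h x).le⟩ x

/-- Polar decomposition of `A`, up to the partial isometry, with `Q ^ 2 = |A*|`. -/
theorem exists_sqrt_abs_factorization (A : H →L[ℂ] H) :
    ∃ Q V W : H →L[ℂ] H, adjoint Q = Q ∧ A = Q * (Q * V) ∧ A * W = Q * Q := by
  let P := CFC.abs (adjoint A)
  have hP : 0 ≤ P := CFC.abs_nonneg _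
  have hPadj : adjoint P = P := (IsSelfAdjoint.of_nonneg hP).star_eq
  have hQQ : CFC.sqrt P * CFC.sqrt P = P := CFC.sqrt_mul_sqrt_self P hP
  have hPP : P * P = A * adjoint A := by
    simpa [ContinuousLinearMap.star_eq_adjoint] using CFC.abs_mul_abs (adjoint A)
  have hnorm : ∀ x, ‖adjoint A x‖ = ‖P x‖ := fun x => by
    have hinner : ⟪adjoint A x, adjoint A x⟫_ℂ = ⟪P x, P x⟫_ℂ := by
      rw [adjoint_inner_left, ← adjoint_inner_right P, hPadj]
      exact congrArg (fun T : H →L[ℂ] H => ⟪x, T x⟫_ℂ) hPP.symm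
    rw [@norm_eq_sqrt_re_inner ℂ, hinner, ← @norm_eq_sqrt_re_inner ℂ]
  obtain ⟨V, hV⟩ := exists_mul_eq_of_norm_eq hnorm
  obtain ⟨W, hW⟩ := exists_mul_eq_of_norm_eq fun x => (hnorm x).symm
  refine ⟨CFC.sqrt P, adjoint V, adjoint W,
    (IsSelfAdjoint.of_nonneg (CFC.sqrt_nonneg P)).star_eq, ?_, ?_⟩
  · have := congrArg adjoint hV
    rw [← mul_assoc, hQQ]
    simpa [ContinuousLinearMap.mul_def, ContinuousLinearMap.adjoint_comp, hPadj] using this.symm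
  · have := congrArg adjoint hW
    rw [hQQ]
    simpa [ContinuousLinearMap.mul_def, ContinuousLinearMap.adjoint_comp, hPadj] using this

/-- If `A * X` has a summable diagonal for all bounded `X`, then `A * B` and `B * A` have the same
trace, independent of the Hilbert basis. -/
theorem exists_hasSum_trace_mul_comm {ι : Type*} (A B : H →L[ℂ] H)
    (hA : ∀ (b : HilbertBasis ι ℂ H) (X : H →L[ℂ] H),
      Summable fun i => ⟪b i, (A * X) (b i)⟫_ℂ) (b₀ : HilbertBasis ι ℂ H) :
    ∃ t : ℂ, ∀ b : HilbertBasis ι ℂ H, HasSum (fun i => ⟪b i, (A * B) (b i)⟫_ℂ) t ∧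
      HasSum (fun i => ⟪b i, (B * A) (b i)⟫_ℂ) t := by
  obtain ⟨Q, V, W, hQ, hAQ, hAW⟩ := exists_sqrt_abs_factorization A
  have hQs : ∀ b : HilbertBasis ι ℂ H, Summable fun i => ‖Q (b i)‖ ^ 2 := fun b => by
    refine (Complex.hasSum_re (hA b W).hasSum).summable.congr fun i => ?_
    rw [hAW, mul_apply_eq_comp, ← adjoint_inner_left, hQ]
    exact inner_self_eq_norm_sq (𝕜 := ℂ) (Q (b i))
  have hleft : ∀ (X : H →L[ℂ] H) (b : HilbertBasis ι ℂ H),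
      Summable fun i => ‖(X * Q) (b i)‖ ^ 2 := fun X b => by
    refine Summable.of_nonneg_of_le (fun i => by positivity) (fun i => ?_)
      ((hQs b).mul_left (‖X‖ ^ 2))
    rw [← mul_pow]
    gcongr
    exact X.le_opNorm _
  have hadj : ∀ X : H →L[ℂ] H, adjoint (Q * X) = adjoint X * Q := fun X => by
    simp [ContinuousLinearMap.mul_def, ContinuousLinearMap.adjoint_comp, hQ]
  have hright : ∀ (X : H →L[ℂ] H) (b : HilbertBasis ι ℂ H),
      Summable fun i => ‖(Q * X) (b i)‖ ^ 2 := fun X b => by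
    have := summable_norm_adjoint_sq b b (hleft (adjoint X) b)
    rwa [← hadj, ContinuousLinearMap.adjoint_adjoint] at this
  have hBA : ∀ b c : HilbertBasis ι ℂ H, HasSum (fun i => ⟪c i, (B * A) (c i)⟫_ℂ)
      (∑' i, ⟪b i, (A * B) (b i)⟫_ℂ) := fun b c => by
    have h₁ := hasSum_trace_mul_comm b b (X := Q) (Y := Q * V * B)
      (by simpa only [hQ] using hQs b) (by simpa only [mul_assoc] using hright (V * B) b)
    have h₂ := hasSum_trace_mul_comm b c (X := Q * V) (Y := B * Q)
      (by simpa only [hadj] using hleft (adjoint V) b) (hleft B b)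
    have e₁ : A * B = Q * (Q * V * B) := by rw [hAQ]; simp only [mul_assoc]
    have e₂ : B * A = B * Q * (Q * V) := by rw [hAQ]; simp only [mul_assoc]
    rw [e₁, e₂, ← h₁.tsum_eq]
    simpa only [mul_assoc] using h₂
  refine ⟨∑' i, ⟪b₀ i, (A * B) (b₀ i)⟫_ℂ, fun b => ⟨?_, hBA b₀ b⟩⟩
  rw [(hBA b₀ b).unique (hBA b b)]
  exact (hA b B).hasSum

end Polar

/-- The image of a Hilbert basis under a conjugation is a Hilbert basis. -/
theorem HilbertBasis.exists_conjugation {H ι : Type*} [NormedAddCommGroup H]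
    [InnerProductSpace ℂ H] [CompleteSpace H] (C : H → H) (hinv : ∀ x, C (C x) = x)
    (hC : ∀ x y, ⟪C x, C y⟫_ℂ = ⟪y, x⟫_ℂ) (b : HilbertBasis ι ℂ H) :
    ∃ c : HilbertBasis ι ℂ H, ∀ i, c i = C (b i) := by
  classical
  have hv : Orthonormal ℂ fun i => C (b i) := by
    rw [orthonormal_iff_ite]
    intro i j
    rw [hC, orthonormal_iff_ite.1 b.orthonormal]
    simp only [eq_comm]
  have hbot : (Submodule.span ℂ (Set.range fun i => C (b i)))ᗮ = ⊥ := by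
    rw [Submodule.eq_bot_iff]
    intro x hx
    have hzero : ∀ i, ⟪b i, C x⟫_ℂ = 0 := fun i => by
      rw [← hC, hinv]
      exact (Submodule.mem_orthogonal' _ x).1 hx _ (Submodule.subset_span ⟨i, rfl⟩)
    have hnorm : ‖C x‖ ^ 2 = 0 := by
      rw [← (b.hasSum_norm_inner_sq (C x)).tsum_eq]
      simp [hzero]
    have hCx : C x = 0 := by simpa using hnorm
    rw [← inner_self_eq_zero (𝕜 := ℂ), ← hC, hCx, inner_zero_left]
  exact ⟨HilbertBasis.mkOfOrthogonalEqBot hv hbot, fun i => by simp⟩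

theorem trace_symmetric_mul_skew_eq_zero {H : Type*} [NormedAddCommGroup H]
    [InnerProductSpace ℂ H] [CompleteSpace H]
    [TopologicalSpace.SeparableSpace H] (C : H → H)
    (hadd : ∀ x y, C (x + y) = C x + C y)
    (hsmul : ∀ (a : ℂ) (x : H), C (a • x) = (starRingEnd ℂ a) • C x)
    (hinv : ∀ x, C (C x) = x)
    (hC : ∀ x y, ⟪C x, C y⟫_ℂ = ⟪y, x⟫_ℂ)
    (A B : H →L[ℂ] H)
    (hA : ∀ x, C (A (C x)) = (ContinuousLinearMap.adjoint A) x)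
    (hB : ∀ x, C (B (C x)) = -(ContinuousLinearMap.adjoint B) x)
    -- `A` is trace class: for every bounded `X`, `A * X` has absolutely summable diagonal
    -- in every Hilbert (orthonormal) basis
    (hAtc : ∀ (ι : Type) (b : HilbertBasis ι ℂ H) (X : H →L[ℂ] H),
      Summable fun i => ⟪b i, (A * X) (b i)⟫_ℂ) :
    ∀ (ι : Type) (b : HilbertBasis ι ℂ H),
      HasSum (fun i => ⟪b i, (A * B) (b i)⟫_ℂ) 0 := by
  intro ι b
  obtain ⟨t, ht⟩ := exists_hasSum_trace_mul_comm A B (hAtc ι) b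
  obtain ⟨c, hc⟩ := b.exists_conjugation C hinv hC
  have hdiag : ∀ x, ⟪C x, (A * B) (C x)⟫_ℂ = -⟪x, (B * A) x⟫_ℂ := fun x => by
    have hAB : C ((A * B) (C x)) = -adjoint A (adjoint B x) := by
      rw [mul_apply_eq_comp, ← hinv (B (C x)), hA, hB, map_neg]
    rw [← hinv ((A * B) (C x)), hC, hAB, inner_neg_left, adjoint_inner_left, adjoint_inner_left]
    rfl
  have hneg : HasSum (fun i => ⟪c i, (A * B) (c i)⟫_ℂ) (-t) := by
    simpa only [hc, hdiag] using (ht b).2.neg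
  have ht0 : t = 0 := self_eq_neg.1 ((ht c).1.unique hneg)
  exact ht0 ▸ (ht b).1
end
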